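/- Let s₁, s₂ ≥ 1, 1 ≤ m ≤ min(s₁,s₂), r = s₁+s₂-2m. Applying m successive middle trivial projections π̂^(1) (each contracting the two tensorands adjacent to the interface of the two blocks) to θ_l^{(s₂)} ⊗ θ_k^{(s₁)} yields ((q-q^{-1})^m/[2]_q^m) · ∑_{j=0}^m [m choose j]_q (-1)^j q^{(m-j)(j+l-s₂-1-k)} (∏_{r'=0}^{j-1}[k-r']_q)(∏_{s'=0}^{m-j-1}[l-s']_q) · θ_{l-m+j}^{(s₂-m)} ⊗ θ_{k-j}^{(s₁-m)}, with θ_{-1} = 0. -/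

import Mathlib

noncomputable section
open Finset

/-- `q` is a nonzero complex number that is not a root of unity. -/
def NotRootOfUnity (q : ℂ) : Prop := q ≠ 0 ∧ ∀ m : ℤ, m ≠ 0 → q ^ m ≠ 1

/-- The q-integer `[m]_q = (q^m - q^(-m))/(q - q⁻¹)`. -/
def qint (q : ℂ) (m : ℤ) : ℂ := (q ^ m - q ^ (-m)) / (q - q⁻¹)

/-- The q-factorial `[n]_q! = ∏_{m=1}^n [m]_q`. -/
def qfact (q : ℂ) (n : ℕ) : ℂ := ∏ m ∈ Finset.range n, qint q ((m : ℤ) + 1)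

/-- Coefficient model of the tensor power `M₂^{⊗s}` of the two-dimensional irreducible
`U_q(sl₂)`-module: a vector is the coefficient function of the basis
`e_{l₁} ⊗ ⋯ ⊗ e_{l_s}` (index `0` is the leftmost tensorand). -/
abbrev V (s : ℕ) := (Fin s → Fin 2) → ℂ

/-- The highest weight vector `e₀ ⊗ ⋯ ⊗ e₀` of `M₂^{⊗s}`. -/
def e0 (s : ℕ) : V s := fun m => if ∀ i, m i = 0 then 1 else 0

/-- Action of `F` on `M₂^{⊗s}` via `Δ^(s)(F) = ∑ᵢ (K⁻¹)^{⊗(i-1)} ⊗ F ⊗ 1^{⊗(s-i)}`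
(the first coproduct leg acts on the leftmost tensorand;
`F.e₀ = e₁`, `F.e₁ = 0`, `K⁻¹.e_l = q^{2l-1} e_l` in `M₂`). -/
def Fop (q : ℂ) (s : ℕ) (v : V s) : V s :=
  fun m => ∑ i : Fin s,
    (∏ j : Fin s, if j < i then q ^ (2 * ((m j : ℕ) : ℤ) - 1) else 1) *
      (if m i = 1 then v (Function.update m i 0) else 0)

/-- Action of `E` on `M₂^{⊗s}` via `Δ^(s)(E) = ∑ᵢ 1^{⊗(i-1)} ⊗ E ⊗ K^{⊗(s-i)}`
(`E.e₁ = e₀`, `E.e₀ = 0`, `K.e_l = q^{1-2l} e_l` in `M₂`). -/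
def Eop (q : ℂ) (s : ℕ) (v : V s) : V s :=
  fun m => ∑ i : Fin s,
    (∏ j : Fin s, if i < j then q ^ (1 - 2 * ((m j : ℕ) : ℤ)) else 1) *
      (if m i = 0 then v (Function.update m i 1) else 0)

/-- Action of `K` on `M₂^{⊗s}` (diagonal: `K.e_l = q^{1-2l} e_l` in each tensorand). -/
def Kop (q : ℂ) (s : ℕ) (v : V s) : V s :=
  fun m => (∏ j : Fin s, q ^ (1 - 2 * ((m j : ℕ) : ℤ))) * v m

/-- The vector `θ_k^(s) = F^k.(e₀ ⊗ ⋯ ⊗ e₀)` in `M₂^{⊗s}`. -/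
def theta (q : ℂ) (s k : ℕ) : V s := (Fop q s)^[k] (e0 s)

/-- Insert the values `a`, `b` at (0-indexed) positions `j`, `j+1` into the multi-index `m`. -/
def insert2 (s j : ℕ) (m : Fin (s - 2) → Fin 2) (a b : Fin 2) : Fin s → Fin 2 :=
  fun i =>
    if (i : ℕ) < j then (if h : (i : ℕ) < s - 2 then m ⟨i, h⟩ else 0)
    else if (i : ℕ) = j then a
    else if (i : ℕ) = j + 1 then b
    else (if h : (i : ℕ) - 2 < s - 2 then m ⟨(i : ℕ) - 2, h⟩ else 0)

/-- Matrix coefficients of the `U_q(sl₂)`-equivariant projection `π̂^(1) : M₂ ⊗ M₂ → ℂ`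
onto the trivial summand (normalized so that the Clebsch–Gordan singlet maps to `1`):
`π̂(e₀⊗e₀) = π̂(e₁⊗e₁) = 0`, `π̂(e₀⊗e₁) = (q⁻¹-q)/[2]_q`, `π̂(e₁⊗e₀) = (1-q⁻²)/[2]_q`
(the first argument is the left tensorand). -/
def pival (q : ℂ) (a b : Fin 2) : ℂ :=
  if a = 0 ∧ b = 1 then (q⁻¹ - q) / qint q 2
  else if a = 1 ∧ b = 0 then (1 - q ^ (-2 : ℤ)) / qint q 2
  else 0

/-- The projection `π̂_j^(1) : M₂^{⊗s} → M₂^{⊗(s-2)}` contracting the tensorands at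
(0-indexed) positions `j`, `j+1` with `π̂^(1)`. -/
def pihat (q : ℂ) (s j : ℕ) (v : V s) : V (s - 2) :=
  fun m => ∑ a : Fin 2, ∑ b : Fin 2, pival q a b * v (insert2 s j m a b)

/-- The tensor product map `M₂^{⊗s₂} ⊗ M₂^{⊗s₁} → M₂^{⊗(s₂+s₁)}` (left block first). -/
def tens {s₂ s₁ : ℕ} (v : V s₂) (w : V s₁) : V (s₂ + s₁) :=
  fun m => v (fun i => m (Fin.castAdd s₁ i)) * w (fun i => m (Fin.natAdd s₂ i))

/-- Transport of vectors along an equality of the number of tensor factors. -/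
def reindex {n n' : ℕ} (h : n = n') (v : V n) : V n' :=
  fun m => v (fun i => m (Fin.cast h i))

/-- `t` successive middle projections: at each step the projection `π̂^(1)` contracts the
two tensorands adjacent to the interface of the two blocks (the interface moves one
step to the left in the left block after each contraction). -/
def pihatIter (q : ℂ) : (t : ℕ) → (s j : ℕ) → V s → V (s - 2 * t)
  | 0, _, _, v => v
  | (t + 1), s, j, v => reindex (by omega) (pihatIter q t (s - 2) (j - 1) (pihat q s j v))

/-- The q-binomial coefficient `[n choose k]_q = [n]_q! / ([k]_q! [n-k]_q!)`. -/
def qbinom (q : ℂ) (n k : ℕ) : ℂ := qfact q n / (qfact q k * qfact q (n - k))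


theorem aux_qne (q : ℂ) (hq : NotRootOfUnity q) : q - q⁻¹ ≠ 0 := by
  intro h
  have h0 := hq.1
  have h2 := hq.2 2 (by norm_num)
  apply h2
  have : q = q⁻¹ := sub_eq_zero.mp h
  rw [zpow_ofNat, pow_two]
  nth_rewrite 2 [this]
  exact mul_inv_cancel₀ h0

theorem aux_qint_ne (q : ℂ) (hq : NotRootOfUnity q) (n : ℤ) (hn : n ≠ 0) : qint q n ≠ 0 := by
  have h0 := hq.1
  unfold qint
  refine div_ne_zero ?_ (aux_qne q hq)
  intro h
  have h2 := hq.2 (2 * n) (by omega)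
  apply h2
  have : q ^ n = q ^ (-n) := sub_eq_zero.mp h
  rw [two_mul, zpow_add₀ h0]
  nth_rewrite 2 [this]
  rw [← zpow_add₀ h0]; simp

theorem aux_qint_zero (q : ℂ) : qint q 0 = 0 := by simp [qint]

theorem aux_qint_add (q : ℂ) (h0 : q ≠ 0) (a b : ℤ) :
    qint q (a + b) = q ^ (-a) * qint q b + q ^ b * qint q a := by
  unfold qint
  rw [neg_add, zpow_add₀ h0, zpow_add₀ h0]
  ring

theorem aux_qfact_ne (q : ℂ) (hq : NotRootOfUnity q) (n : ℕ) : qfact q n ≠ 0 := by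
  unfold qfact
  exact Finset.prod_ne_zero_iff.mpr fun i _ => aux_qint_ne q hq _ (by omega)

theorem aux_qfact_succ (q : ℂ) (n : ℕ) : qfact q (n + 1) = qfact q n * qint q ((n : ℤ) + 1) := by
  unfold qfact
  rw [Finset.prod_range_succ]

theorem aux_pascal (q : ℂ) (hq : NotRootOfUnity q) (m j : ℕ) (hj : j < m) :
    qbinom q (m + 1) (j + 1) =
      q ^ (-((j : ℤ) + 1)) * qbinom q m (j + 1) + q ^ ((m : ℤ) - j) * qbinom q m j := by
  obtain ⟨d, rfl⟩ : ∃ d, m = j + 1 + d := ⟨m - j - 1, by omega⟩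
  unfold qbinom
  have e1 : j + 1 + d + 1 - (j + 1) = d + 1 := by omega
  have e2 : j + 1 + d - (j + 1) = d := by omega
  have e3 : j + 1 + d - j = d + 1 := by omega
  rw [e1, e2, e3, aux_qfact_succ q (j + 1 + d), aux_qfact_succ q d, aux_qfact_succ q j]
  have h1 := aux_qfact_ne q hq d
  have h2 := aux_qfact_ne q hq j
  have h3 := aux_qint_ne q hq ((d : ℤ) + 1) (by omega)
  have h4 := aux_qint_ne q hq ((j : ℤ) + 1) (by omega)
  have h5 : qint q (((j + 1 + d : ℕ) : ℤ) + 1)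
      = q ^ (-((j : ℤ) + 1)) * qint q ((d : ℤ) + 1)
        + q ^ (((j + 1 + d : ℕ) : ℤ) - j) * qint q ((j : ℤ) + 1) := by
    have : (((j + 1 + d : ℕ) : ℤ) + 1) = ((j : ℤ) + 1) + ((d : ℤ) + 1) := by push_cast; ring
    rw [this, aux_qint_add q hq.1]
    congr 3
    push_cast; ring
  rw [h5]
  generalize q ^ (-((j : ℤ) + 1)) = x
  generalize q ^ (((j + 1 + d : ℕ) : ℤ) - j) = y
  field_simp

theorem aux_binom_zero (q : ℂ) (hq : NotRootOfUnity q) (m : ℕ) : qbinom q m 0 = 1 := by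
  have := aux_qfact_ne q hq m
  simp [qbinom, qfact] at *
  exact this

theorem aux_binom_self (q : ℂ) (hq : NotRootOfUnity q) (m : ℕ) : qbinom q m m = 1 := by
  have := aux_qfact_ne q hq m
  simp [qbinom, qfact] at *
  exact this

/-! ### The operator `F` -/

theorem aux_Fop_smul (q : ℂ) (s : ℕ) (c : ℂ) (v : V s) (m : Fin s → Fin 2) :
    Fop q s (fun x => c * v x) m = c * Fop q s v m := by
  unfold Fop
  rw [Finset.mul_sum]
  refine Finset.sum_congr rfl fun i _ => ?_
  split_ifs <;> ring

theorem aux_Fop_cons (q : ℂ) (n : ℕ) (v : V (n + 1)) (a : Fin 2) (m : Fin n → Fin 2) :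
    Fop q (n + 1) v (Fin.cons a m : Fin (n + 1) → Fin 2) =
      (if a = 1 then v (Fin.cons 0 m : Fin (n + 1) → Fin 2) else 0) +
      q ^ (2 * ((a : ℕ) : ℤ) - 1) *
        Fop q n (fun x => v (Fin.cons a x : Fin (n + 1) → Fin 2)) m := by
  unfold Fop
  rw [Fin.sum_univ_succ]
  congr 1
  · simp [Fin.update_cons_zero]
  · rw [Finset.mul_sum]
    refine Finset.sum_congr rfl fun i _ => ?_
    rw [Fin.prod_univ_succ]
    simp only [Fin.succ_pos, if_true, Fin.cons_zero, Fin.cons_succ, Fin.succ_lt_succ_iff,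
      ← Fin.cons_update]
    ring

theorem aux_Fop_snoc (q : ℂ) (n : ℕ) (v : V (n + 1)) (b : Fin 2) (m : Fin n → Fin 2) :
    Fop q (n + 1) v (Fin.snoc m b : Fin (n + 1) → Fin 2) =
      Fop q n (fun x => v (Fin.snoc x b : Fin (n + 1) → Fin 2)) m +
      (if b = 1 then (∏ j, q ^ (2 * ((m j : ℕ) : ℤ) - 1)) *
        v (Fin.snoc m 0 : Fin (n + 1) → Fin 2) else 0) := by
  unfold Fop
  rw [Fin.sum_univ_castSucc]
  congr 1
  · refine Finset.sum_congr rfl fun i _ => ?_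
    rw [Fin.prod_univ_castSucc]
    simp only [Fin.snoc_castSucc, Fin.castSucc_lt_castSucc_iff, ← Fin.snoc_update]
    rw [if_neg (not_lt.mpr (Fin.le_last _)), mul_one]
  · rw [Fin.prod_univ_castSucc]
    simp [Fin.castSucc_lt_last, Fin.update_snoc_last]

theorem aux_theta_succ (q : ℂ) (s k : ℕ) : theta q s (k + 1) = Fop q s (theta q s k) := by
  unfold theta
  rw [Function.iterate_succ_apply']

theorem aux_weight_Fop (q : ℂ) (h0 : q ≠ 0) (n : ℕ) (v : V n) (m : Fin n → Fin 2) :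
    (∏ j, q ^ (2 * ((m j : ℕ) : ℤ) - 1)) * Fop q n v m =
      q ^ 2 * Fop q n (fun x => (∏ j, q ^ (2 * ((x j : ℕ) : ℤ) - 1)) * v x) m := by
  unfold Fop
  rw [Finset.mul_sum, Finset.mul_sum]
  refine Finset.sum_congr rfl fun i _ => ?_
  split_ifs with h
  · have : (∏ j, q ^ (2 * ((m j : ℕ) : ℤ) - 1)) =
        q ^ 2 * ∏ j, q ^ (2 * (((Function.update m i 0) j : ℕ) : ℤ) - 1) := by
      rw [← Finset.mul_prod_erase _ _ (Finset.mem_univ i),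
        ← Finset.mul_prod_erase _ (fun j => q ^ (2 * (((Function.update m i 0) j : ℕ) : ℤ) - 1))
          (Finset.mem_univ i), h]
      have e : ∏ x ∈ Finset.univ.erase i, q ^ (2 * (((Function.update m i 0) x : ℕ) : ℤ) - 1)
          = ∏ x ∈ Finset.univ.erase i, q ^ (2 * ((m x : ℕ) : ℤ) - 1) := by
        refine Finset.prod_congr rfl fun x hx => ?_
        rw [Function.update_of_ne (Finset.ne_of_mem_erase hx)]
      rw [e, ← mul_assoc]
      congr 1
      simp
      field_simp
    rw [this]; ring
  · ring

theorem aux_weight_theta (q : ℂ) (h0 : q ≠ 0) (n l : ℕ) (m : Fin n → Fin 2) :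
    (∏ j, q ^ (2 * ((m j : ℕ) : ℤ) - 1)) * theta q n l m =
      q ^ (2 * (l : ℤ) - n) * theta q n l m := by
  induction l generalizing m with
  | zero =>
    simp only [theta, Function.iterate_zero, id, e0]
    split_ifs with h
    · simp [h]
    · simp
  | succ l ih =>
    rw [aux_theta_succ, aux_weight_Fop q h0]
    have : (fun x => (∏ j, q ^ (2 * ((x j : ℕ) : ℤ) - 1)) * theta q n l x)
      = fun x => q ^ (2 * (l : ℤ) - n) * theta q n l x := funext ih
    rw [this, aux_Fop_smul, ← mul_assoc]
    congr 1
    rw [← zpow_natCast, ← zpow_add₀ h0]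
    congr 1
    push_cast; ring

theorem aux_qmul_theta (q : ℂ) (n k : ℕ) (m : Fin n → Fin 2) :
    qint q k * Fop q n (theta q n (k - 1)) m = qint q k * theta q n k m := by
  cases k with
  | zero => simp [aux_qint_zero]
  | succ k => rw [aux_theta_succ]; rfl

theorem aux_theta_cons (q : ℂ) (hq : NotRootOfUnity q) (n k : ℕ) (m : Fin n → Fin 2) :
    theta q (n + 1) k (Fin.cons 0 m : Fin (n + 1) → Fin 2) = q ^ (-(k : ℤ)) * theta q n k m ∧
    theta q (n + 1) k (Fin.cons 1 m : Fin (n + 1) → Fin 2) = qint q k * theta q n (k - 1) m := by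
  have h0 := hq.1
  induction k generalizing m with
  | zero =>
    simp [theta, e0, aux_qint_zero, Fin.forall_fin_succ]
  | succ k ih =>
    have i0 : (fun x => theta q (n + 1) k (Fin.cons 0 x : Fin (n + 1) → Fin 2)) =
      fun x => q ^ (-(k : ℤ)) * theta q n k x := funext fun x => (ih x).1
    have i1 : (fun x => theta q (n + 1) k (Fin.cons 1 x : Fin (n + 1) → Fin 2)) =
      fun x => qint q k * theta q n (k - 1) x := funext fun x => (ih x).2
    rw [aux_theta_succ, aux_Fop_cons, aux_Fop_cons, i0, i1, aux_Fop_smul, aux_Fop_smul,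
      aux_qmul_theta, (ih m).1, ← aux_theta_succ]
    constructor
    · simp only [zero_ne_one, if_false, zero_add, ← mul_assoc]
      congr 1
      rw [← zpow_add₀ h0]
      congr 1
      simp
    · simp only [if_true, Nat.cast_add, Nat.cast_one, Nat.add_sub_cancel]
      rw [aux_qint_add q h0]
      have : qint q 1 = 1 := by
        unfold qint
        simpa using div_self (aux_qne q hq)
      rw [this]
      simp
      ring

theorem aux_theta_snoc (q : ℂ) (hq : NotRootOfUnity q) (n l : ℕ) (m : Fin n → Fin 2) :
    theta q (n + 1) l (Fin.snoc m 0 : Fin (n + 1) → Fin 2) = theta q n l m ∧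
    theta q (n + 1) l (Fin.snoc m 1 : Fin (n + 1) → Fin 2) =
      q ^ ((l : ℤ) - n - 1) * qint q l * theta q n (l - 1) m := by
  have h0 := hq.1
  induction l generalizing m with
  | zero =>
    simp [theta, e0, aux_qint_zero, Fin.forall_fin_succ']
  | succ l ih =>
    have i0 : (fun x => theta q (n + 1) l (Fin.snoc x 0 : Fin (n + 1) → Fin 2)) =
      fun x => theta q n l x := funext fun x => (ih x).1
    have i1 : (fun x => theta q (n + 1) l (Fin.snoc x 1 : Fin (n + 1) → Fin 2)) =
      fun x => q ^ ((l : ℤ) - n - 1) * qint q l * theta q n (l - 1) x := funext fun x => (ih x).2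
    rw [aux_theta_succ, aux_Fop_snoc, aux_Fop_snoc, i0, i1, aux_Fop_smul, mul_assoc _ (qint q l),
      aux_qmul_theta, (ih m).1, ← aux_theta_succ, aux_weight_theta q h0]
    constructor
    · simp
    · simp only [if_true, Nat.cast_add, Nat.cast_one, Nat.add_sub_cancel]
      have : qint q 1 = 1 := by
        unfold qint
        simpa using div_self (aux_qne q hq)
      rw [add_comm (l : ℤ) 1, aux_qint_add q h0, this]
      have e1 : q ^ ((l : ℤ) - n - 1) = q ^ (1 + (l : ℤ) - n - 1) * q ^ (-1 : ℤ) := by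
        rw [← zpow_add₀ h0]; congr 1; ring
      have e2 : q ^ (2 * (l : ℤ) - n) = q ^ (1 + (l : ℤ) - n - 1) * q ^ (l : ℤ) := by
        rw [← zpow_add₀ h0]; congr 1; ring
      rw [e1, e2]
      ring

/-! ### The single projection -/

theorem aux_single (q : ℂ) (hq : NotRootOfUnity q) (n p l k : ℕ) :
    pihat q (n + 1 + (p + 1)) n (tens (theta q (n + 1) l) (theta q (p + 1) k)) =
      fun mm => (q - q⁻¹) / qint q 2 *
       (q ^ ((l : ℤ) - (n + 1) - 1 - k) * qint q l *
        reindex (show n + p = n + 1 + (p + 1) - 2 by omega)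
          (tens (theta q n (l - 1)) (theta q p k)) mm
        - qint q k * reindex (show n + p = n + 1 + (p + 1) - 2 by omega)
          (tens (theta q n l) (theta q p (k - 1))) mm) := by
  have h0 := hq.1
  funext mm
  have hE : n + p = n + 1 + (p + 1) - 2 := by omega
  set ml : Fin n → Fin 2 := fun i => mm (Fin.cast hE (Fin.castAdd p i)) with hml
  set mr : Fin p → Fin 2 := fun i => mm (Fin.cast hE (Fin.natAdd n i)) with hmr
  have A : ∀ a b, (fun i => insert2 (n + 1 + (p + 1)) n mm a b (Fin.castAdd (p + 1) i))
      = (Fin.snoc ml a : Fin (n + 1) → Fin 2) := by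
    intro a b
    funext i
    refine Fin.lastCases ?_ (fun i => ?_) i
    · simp [insert2]
    · have : (i : ℕ) < n + 1 + (p + 1) - 2 := by omega
      simp [insert2, hml, this]
      rfl
  have B : ∀ a b, (fun i => insert2 (n + 1 + (p + 1)) n mm a b (Fin.natAdd (n + 1) i))
      = (Fin.cons b mr : Fin (p + 1) → Fin 2) := by
    intro a b
    funext i
    refine Fin.cases ?_ (fun i => ?_) i
    · simp [insert2]
    · have h1 : ¬ (n + 1 + ((i : ℕ) + 1) < n) := by omega
      have h2 : ¬ (n + 1 + ((i : ℕ) + 1) = n) := by omega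
      have h3 : ¬ (n + 1 + ((i : ℕ) + 1) = n + 1) := by omega
      have h4 : n + 1 + ((i : ℕ) + 1) - 2 < n + 1 + (p + 1) - 2 := by omega
      simp only [insert2, hmr, Fin.val_natAdd, Fin.val_succ, h1, h2, h3, h4, if_false, dif_pos,
        Fin.cons_succ]
      congr 1
      apply Fin.ext
      simp
      omega
  simp only [pihat, tens, reindex, A, B, Fin.sum_univ_two, pival]
  rw [(aux_theta_cons q hq p k mr).1, (aux_theta_cons q hq p k mr).2,
    (aux_theta_snoc q hq n l ml).1, (aux_theta_snoc q hq n l ml).2]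
  have e1 : q ^ ((l : ℤ) - (n + 1) - 1 - k) = q ^ ((l : ℤ) - n - 1) * q ^ (-(k : ℤ)) * q⁻¹ := by
    rw [← zpow_neg_one, ← zpow_add₀ h0, ← zpow_add₀ h0]; congr 1; ring
  have e2 : (1 - q ^ (-2 : ℤ)) = (q - q⁻¹) * q⁻¹ := by
    rw [zpow_neg, zpow_ofNat]; field_simp
  rw [e1, e2]
  simp [← hml, ← hmr]
  ring

/-! ### Linearity of the iterated projection -/

theorem aux_pihat_lin (q : ℂ) (s j : ℕ) (c d e : ℂ) (v w : V s) :
    pihat q s j (fun x => c * (d * v x - e * w x)) =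
      fun x => c * (d * pihat q s j v x - e * pihat q s j w x) := by
  funext m
  simp only [pihat, Fin.sum_univ_two]
  ring

theorem aux_iter_lin (q : ℂ) (t s j : ℕ) (c d e : ℂ) (v w : V s) :
    pihatIter q t s j (fun x => c * (d * v x - e * w x)) =
      fun x => c * (d * pihatIter q t s j v x - e * pihatIter q t s j w x) := by
  induction t generalizing s j with
  | zero => rfl
  | succ t ih =>
    simp only [pihatIter]
    rw [aux_pihat_lin, ih]
    rfl

theorem aux_iter_reindex (q : ℂ) (t s s' j : ℕ) (h : s = s') (v : V s) :
    pihatIter q t s' j (reindex h v) =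
      reindex (by omega) (pihatIter q t s j v) := by
  subst h
  rfl

/-! ### The combinatorial step -/

theorem aux_sum_split (m : ℕ) (D α β : ℕ → ℂ) (h0 : D 0 = α 0) (h1 : D (m + 1) = β m)
    (h : ∀ j < m, D (j + 1) = α (j + 1) + β j) :
    ∑ j ∈ range (m + 1 + 1), D j = ∑ j ∈ range (m + 1), α j + ∑ j ∈ range (m + 1), β j := by
  rw [Finset.sum_range_succ, Finset.sum_range_succ', Finset.sum_range_succ' α,
    Finset.sum_range_succ β, h0, h1, Finset.sum_congr rfl fun j hj => h j (Finset.mem_range.mp hj),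
    Finset.sum_add_distrib]
  ring

/-- The coefficients of the `m`-fold formula, without the binomial. -/
def auxC (q : ℂ) (m s₂ l k j : ℕ) : ℂ :=
  (-1) ^ j * q ^ (((m : ℤ) - (j : ℤ)) * ((j : ℤ) + (l : ℤ) - (s₂ : ℤ) - 1 - (k : ℤ))) *
    (∏ r ∈ Finset.range j, qint q ((k : ℤ) - (r : ℤ))) *
    (∏ t ∈ Finset.range (m - j), qint q ((l : ℤ) - (t : ℤ)))

theorem aux_C_left (q : ℂ) (h0 : q ≠ 0) (m s l k j : ℕ) (hj : j ≤ m) :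
    q ^ ((l : ℤ) - (s + 1) - 1 - k) * qint q l * auxC q m s (l - 1) k j =
      q ^ (-(j : ℤ)) * auxC q (m + 1) (s + 1) l k j := by
  obtain ⟨d, rfl⟩ : ∃ d, m = j + d := ⟨m - j, by omega⟩
  have e1 : j + d + 1 - j = d + 1 := by omega
  have e2 : j + d - j = d := by omega
  unfold auxC
  rw [e1, e2, Finset.prod_range_succ' _ d]
  cases l with
  | zero => simp [aux_qint_zero]
  | succ l =>
    have e3 : ∀ t : ℕ, ((l + 1 : ℕ) : ℤ) - ((t + 1 : ℕ) : ℤ) = (l : ℤ) - t := by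
      intro t; push_cast; ring
    simp only [e3, Nat.add_sub_cancel, Nat.cast_zero, sub_zero]
    have e4 : q ^ (((l + 1 : ℕ) : ℤ) - (s + 1) - 1 - k) *
        q ^ ((((j + d : ℕ) : ℤ) - (j : ℤ)) * ((j : ℤ) + (l : ℤ) - (s : ℤ) - 1 - (k : ℤ))) =
        q ^ (-(j : ℤ)) * q ^ ((((j + d + 1 : ℕ) : ℤ) - (j : ℤ)) *
          ((j : ℤ) + ((l + 1 : ℕ) : ℤ) - ((s + 1 : ℕ) : ℤ) - 1 - (k : ℤ))) := by
      rw [← zpow_add₀ h0, ← zpow_add₀ h0]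
      congr 1
      push_cast; ring
    linear_combination (qint q ((l + 1 : ℕ) : ℤ) * (-1) ^ j *
      (∏ r ∈ Finset.range j, qint q ((k : ℤ) - (r : ℤ))) *
      (∏ t ∈ Finset.range d, qint q ((l : ℤ) - (t : ℤ)))) * e4

theorem aux_C_right (q : ℂ) (h0 : q ≠ 0) (m s l k j : ℕ) :
    - (qint q k * auxC q m s l (k - 1) j) =
      q ^ ((m : ℤ) - j) * auxC q (m + 1) (s + 1) l k (j + 1) := by
  have e1 : m + 1 - (j + 1) = m - j := by omega
  unfold auxC
  rw [e1, Finset.prod_range_succ' _ j]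
  cases k with
  | zero => simp [aux_qint_zero]
  | succ k =>
    have e3 : ∀ t : ℕ, ((k + 1 : ℕ) : ℤ) - ((t + 1 : ℕ) : ℤ) = (k : ℤ) - t := by
      intro t; push_cast; ring
    simp only [e3, Nat.add_sub_cancel, Nat.cast_zero, sub_zero]
    have e4 : q ^ (((m : ℤ) - (j : ℤ)) * ((j : ℤ) + (l : ℤ) - (s : ℤ) - 1 - (k : ℤ))) =
        q ^ ((m : ℤ) - j) * q ^ ((((m + 1 : ℕ) : ℤ) - ((j + 1 : ℕ) : ℤ)) *
          (((j + 1 : ℕ) : ℤ) + (l : ℤ) - ((s + 1 : ℕ) : ℤ) - 1 - ((k + 1 : ℕ) : ℤ))) := by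
      rw [← zpow_add₀ h0]
      congr 1
      push_cast; ring
    rw [e4]
    ring

theorem aux_comb (q : ℂ) (hq : NotRootOfUnity q) (m s l k : ℕ) (X : ℕ → ℕ → ℂ) :
    ∑ j ∈ range (m + 1 + 1), qbinom q (m + 1) j * auxC q (m + 1) (s + 1) l k j *
        X (l + j - (m + 1)) (k - j) =
      q ^ ((l : ℤ) - (s + 1) - 1 - k) * qint q l *
        (∑ j ∈ range (m + 1), qbinom q m j * auxC q m s (l - 1) k j * X (l - 1 + j - m) (k - j))
      - qint q k *
        (∑ j ∈ range (m + 1), qbinom q m j * auxC q m s l (k - 1) j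
          * X (l + j - m) (k - 1 - j)) := by
  have h0 := hq.1
  rw [aux_sum_split m _
    (fun j => q ^ (-(j : ℤ)) * qbinom q m j * auxC q (m + 1) (s + 1) l k j *
        X (l + j - (m + 1)) (k - j))
    (fun j => q ^ ((m : ℤ) - j) * qbinom q m j * auxC q (m + 1) (s + 1) l k (j + 1) *
        X (l + (j + 1) - (m + 1)) (k - (j + 1)))]
  · rw [sub_eq_add_neg, Finset.mul_sum, Finset.mul_sum, ← Finset.sum_neg_distrib]
    congr 1
    · refine Finset.sum_congr rfl fun j hj => ?_
      have hj' : j ≤ m := by simp at hj; omega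
      have e : l - 1 + j - m = l + j - (m + 1) := by omega
      rw [e]
      linear_combination (- qbinom q m j * X (l + j - (m + 1)) (k - j)) *
        aux_C_left q h0 m s l k j hj'
    · refine Finset.sum_congr rfl fun j hj => ?_
      have e : l + (j + 1) - (m + 1) = l + j - m := by omega
      have e' : k - (j + 1) = k - 1 - j := by omega
      rw [e, e']
      linear_combination (- qbinom q m j * X (l + j - m) (k - 1 - j)) *
        aux_C_right q h0 m s l k j
  · simp [aux_binom_zero q hq]
  · simp [aux_binom_self q hq]
  · intro j hj
    rw [aux_pascal q hq m j hj]
    push_cast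
    ring

/-! ### The induction -/

theorem aux_main (q : ℂ) (hq : NotRootOfUnity q) (a b m l k : ℕ) :
    pihatIter q m (a + m + (b + m)) (a + m - 1) (tens (theta q (a + m) l) (theta q (b + m) k))
      = fun mm => ((q - q⁻¹) ^ m / qint q 2 ^ m) *
          ∑ j ∈ Finset.range (m + 1),
            qbinom q m j * auxC q m (a + m) l k j *
              tens (theta q a (l + j - m)) (theta q b (k - j))
                (fun i => mm (Fin.cast (by omega) i)) := by
  induction m generalizing l k with
  | zero =>
    funext mm
    simp [pihatIter, auxC, qbinom, qfact]
  | succ m ih =>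
    have hs := aux_single q hq (a + m) (b + m) l k
    have hstep : pihatIter q (m + 1) (a + (m + 1) + (b + (m + 1))) (a + (m + 1) - 1)
        (tens (theta q (a + (m + 1)) l) (theta q (b + (m + 1)) k)) =
        reindex (by omega) (pihatIter q m (a + m + 1 + (b + m + 1) - 2) (a + m - 1)
          (pihat q (a + m + 1 + (b + m + 1)) (a + m)
            (tens (theta q (a + m + 1) l) (theta q (b + m + 1) k)))) := rfl
    rw [hstep, hs, aux_iter_lin, aux_iter_reindex, aux_iter_reindex, ih, ih]
    funext mm
    have hc := aux_comb q hq m (a + m) l k (fun x y => tens (theta q a x) (theta q b y)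
                (fun i => mm (Fin.cast (by omega) i)))
    simp only [← add_assoc] at hc ⊢
    rw [hc]
    simp only [reindex, Fin.cast_cast]
    push_cast
    ring

theorem aux_tens_cast (q : ℂ) (a a' b b' x y N : ℕ) (ha : a = a') (hb : b = b')
    (h : a + b = N) (h' : a' + b' = N) (mm : Fin N → Fin 2) :
    tens (theta q a x) (theta q b y) (fun i => mm (Fin.cast h i)) =
    tens (theta q a' x) (theta q b' y) (fun i => mm (Fin.cast h' i)) := by
  subst ha hb
  rfl

/-- The `m`-fold middle projection formula: applying `m` successive middle trivial
projections to `θ_l^{(s₂)} ⊗ θ_k^{(s₁)}` yields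
`((q-q⁻¹)^m/[2]_q^m) ∑_{j=0}^m [m choose j]_q (-1)^j q^{(m-j)(j+l-s₂-1-k)}
  (∏_{r'=0}^{j-1}[k-r']_q)(∏_{s'=0}^{m-j-1}[l-s']_q) θ_{l-m+j}^{(s₂-m)} ⊗ θ_{k-j}^{(s₁-m)}`,
with `θ_{-1} = 0` (realized by truncated subtraction in the indices `l+j-m`, `k-j`;
in the out-of-range cases the displayed coefficient products vanish). -/
theorem iterated_middle_projection_of_theta_tensor
    (q : ℂ) (hq : NotRootOfUnity q) (s₁ s₂ : ℕ) (hs₁ : 1 ≤ s₁) (hs₂ : 1 ≤ s₂)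
    (m : ℕ) (hm : 1 ≤ m) (hm₁ : m ≤ s₁) (hm₂ : m ≤ s₂)
    (l k : ℕ) (hl : l ≤ s₂) (hk : k ≤ s₁) :
    pihatIter q m (s₂ + s₁) (s₂ - 1) (tens (theta q s₂ l) (theta q s₁ k))
      = fun mm => ((q - q⁻¹) ^ m / qint q 2 ^ m) *
          ∑ j ∈ Finset.range (m + 1),
            qbinom q m j * (-1) ^ j *
              q ^ (((m : ℤ) - (j : ℤ)) * ((j : ℤ) + (l : ℤ) - (s₂ : ℤ) - 1 - (k : ℤ))) *
              (∏ r ∈ Finset.range j, qint q ((k : ℤ) - (r : ℤ))) *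
              (∏ t ∈ Finset.range (m - j), qint q ((l : ℤ) - (t : ℤ))) *
              tens (theta q (s₂ - m) (l + j - m)) (theta q (s₁ - m) (k - j))
                (fun i => mm (Fin.cast (by omega) i)) := by

  obtain ⟨a, rfl⟩ : ∃ a, s₂ = a + m := ⟨s₂ - m, by omega⟩
  obtain ⟨b, rfl⟩ : ∃ b, s₁ = b + m := ⟨s₁ - m, by omega⟩
  rw [aux_main q hq]
  funext mm
  congr 1
  refine Finset.sum_congr rfl fun j _ => ?_
  rw [aux_tens_cast q a (a + m - m) b (b + m - m) _ _ _ (by omega) (by omega) _ (by omega) mm]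
  unfold auxC
  ring
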